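/- Over the Laurent polynomial ring (Z/5Z)[v,v^{-1}], the ordered product of the Burau matrices B_{i_1}*B_{i_2}*...*B_{i_162}, where (i_1,...,i_162) is the word W = (1,3,1,3,1,3,2,2,1,3,3,2,2,1,3,3,2,2,2,1,3,1,3,2,1,2,1,3,1,3,2,1,2,1,3,1,3,2,2,2,1,3,3,2,2,1,3,3,2,2,1,3,1,3,1,2,3,2,1,1,3,2,1,2,1,3,1,3,2,1,2,1,3,1,3,2,2,1,3,2,2,1,3,2,2,2,1,3,3,2,2,1,3,3,2,2,1,3,1,2,3,2,1,1,3,2,1,2,1,3,1,3,2,1,2,1,3,1,2,3,2,1,1,3,2,2,1,3,3,2,2,1,3,3,2,2,2,1,3,2,2,1,3,1,2,3,2,2,1,3,1,2,3,2,2,1,3,1,2,3,2,1), equals -v^{108} * J, where J is the 3x3 antidiagonal permutation matrix. (This matrix equals the 5-Burau matrix of Delta^{27}, where Delta is the Garside element of B4; hence this word represents an element of B4 whose image equals that of Delta^{27} in the mod-5 Burau representation.) -/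

import Mathlib

open LaurentPolynomial

/-- The reduced Burau matrices for the 4-strand braid group over `R[v,v⁻¹]` (with `v = T 1`),
indexed so that `BurauB R k` is the Burau matrix of the Artin generator `s_k` for `k = 1, 2, 3`. -/
noncomputable def BurauB (R : Type) [CommRing R] : ℕ → Matrix (Fin 3) (Fin 3) (LaurentPolynomial R)
  | 1 => !![-(T 1)^2, -(T 1), 0; 0, 1, 0; 0, 0, 1]
  | 2 => !![1, 0, 0; -(T 1), -(T 1)^2, -(T 1); 0, 0, 1]
  | 3 => !![1, 0, 0; 0, 1, 0; 0, -(T 1), -(T 1)^2]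
  | _ => 1

/-- The 3×3 antidiagonal permutation matrix `J`. -/
noncomputable def Jmat (R : Type) [CommRing R] : Matrix (Fin 3) (Fin 3) (LaurentPolynomial R) :=
  !![0, 0, 1; 0, 1, 0; 1, 0, 0]

/-- The word `W` in the Artin generators (of length 162). -/
def Wword : List ℕ :=
  [1, 3, 1, 3, 1, 3, 2, 2, 1, 3, 3, 2, 2, 1, 3, 3, 2, 2, 2, 1, 3, 1,
   3, 2, 1, 2, 1, 3, 1, 3, 2, 1, 2, 1, 3, 1, 3, 2, 2, 2, 1, 3, 3,
   2, 2, 1, 3, 3, 2, 2, 1, 3, 1, 3, 1, 2, 3, 2, 1, 1, 3, 2, 1, 2, 1, 3,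
   1, 3, 2, 1, 2, 1, 3, 1, 3, 2, 2, 1, 3, 2, 2, 1, 3, 2, 2, 2, 1,
   3, 3, 2, 2, 1, 3, 3, 2, 2, 1, 3, 1, 2, 3, 2, 1, 1, 3, 2, 1, 2, 1,
   3, 1, 3, 2, 1, 2, 1, 3, 1, 2, 3, 2, 1, 1, 3, 2, 2, 1, 3, 3, 2,
   2, 1, 3, 3, 2, 2, 2, 1, 3, 2, 2, 1, 3, 1, 2, 3, 2, 2, 1, 3, 1, 2, 3,
   2, 2, 1, 3, 1, 2, 3, 2, 1]

/-- Evaluation of a coefficient list. -/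
noncomputable def bev : List ℕ → LaurentPolynomial (ZMod 5)
  | [] => 0
  | a :: l => (a : LaurentPolynomial (ZMod 5)) + T 1 * bev l

def bneg : List ℕ → List ℕ
  | [] => []
  | a :: l => ((4 * a) % 5) :: bneg l

def badd : List ℕ → List ℕ → List ℕ
  | [], m => m
  | a :: l, [] => a :: l
  | a :: l, b :: m => ((a + b) % 5) :: badd l m

def bisZ : List ℕ → Bool
  | [] => true
  | a :: l => Nat.beq a 0 && bisZ l

theorem five_zero : (5 : LaurentPolynomial (ZMod 5)) = 0 := by
  have h : ((5 : ℕ) : LaurentPolynomial (ZMod 5)) = 0 := by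
    rw [← map_natCast (LaurentPolynomial.C (R := ZMod 5)) 5]
    have : ((5 : ℕ) : ZMod 5) = 0 := by decide
    rw [this, map_zero]
  exact_mod_cast h

theorem cast_mod_five (a : ℕ) :
    ((a % 5 : ℕ) : LaurentPolynomial (ZMod 5)) = (a : LaurentPolynomial (ZMod 5)) := by
  conv_rhs => rw [← Nat.mod_add_div a 5]
  push_cast
  rw [five_zero]; ring

theorem bev_neg (l : List ℕ) : bev (bneg l) = - bev l := by
  induction l with
  | nil => simp [bev, bneg]
  | cons a l ih =>
    simp only [bev, bneg, ih, cast_mod_five]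
    push_cast
    linear_combination (a : LaurentPolynomial (ZMod 5)) * five_zero

theorem bev_add (l m : List ℕ) : bev (badd l m) = bev l + bev m := by
  induction l generalizing m with
  | nil => simp [bev, badd]
  | cons a l ih =>
    cases m with
    | nil => simp [bev, badd]
    | cons b m =>
      simp only [bev, badd, ih, cast_mod_five]
      push_cast
      ring

theorem bev_isZ (l : List ℕ) (h : bisZ l = true) : bev l = 0 := by
  induction l with
  | nil => rfl
  | cons a l ih =>
    simp only [bisZ, Bool.and_eq_true] at h
    have h0 : a = 0 := Nat.eq_of_beq_eq_true h.1
    simp [bev, ih h.2, h0]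

structure BRow where
  x : List ℕ
  y : List ℕ
  z : List ℕ

noncomputable def BRow.vec (r : BRow) : Fin 3 → LaurentPolynomial (ZMod 5) :=
  ![bev r.x, bev r.y, bev r.z]

def bstep (r : BRow) : ℕ → BRow
  | 1 => ⟨0 :: 0 :: bneg r.x, badd r.y (0 :: bneg r.x), r.z⟩
  | 2 => ⟨badd r.x (0 :: bneg r.y), 0 :: 0 :: bneg r.y, badd r.z (0 :: bneg r.y)⟩
  | 3 => ⟨r.x, badd r.y (0 :: bneg r.z), 0 :: 0 :: bneg r.z⟩
  | _ => r

theorem bstep_vec (r : BRow) (k : ℕ) :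
    (bstep r k).vec = Matrix.vecMul r.vec (BurauB (ZMod 5) k) := by
  have hT : (T 2 : LaurentPolynomial (ZMod 5)) = T 1 ^ 2 := by
    rw [T_pow]; rfl
  unfold bstep BurauB
  split
  all_goals try (simp; done)
  all_goals
    funext i
    fin_cases i <;>
    simp [BRow.vec, bev, bev_add, bev_neg, Matrix.vecMul, dotProduct, Fin.sum_univ_three,
      -LaurentPolynomial.T_pow] <;> (try rw [hT]) <;> ring

theorem brun_vec (L : List ℕ) (r : BRow) :
    (L.foldl bstep r).vec = Matrix.vecMul r.vec (L.map (BurauB (ZMod 5))).prod := by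
  induction L generalizing r with
  | nil => simp
  | cons k L ih => simp [ih, bstep_vec, Matrix.vecMul_vecMul]

def bcheck (r s : BRow) : Bool :=
  bisZ (badd r.x (bneg s.x)) && (bisZ (badd r.y (bneg s.y)) && bisZ (badd r.z (bneg s.z)))

theorem beq_of_isZ (l m : List ℕ) (h : bisZ (badd l (bneg m)) = true) : bev l = bev m := by
  have := bev_isZ _ h
  rw [bev_add, bev_neg] at this
  linear_combination this

theorem bcheck_vec (r s : BRow) (h : bcheck r s = true) : r.vec = s.vec := by
  simp only [bcheck, Bool.and_eq_true] at h
  simp only [BRow.vec, beq_of_isZ _ _ h.1, beq_of_isZ _ _ h.2.1, beq_of_isZ _ _ h.2.2]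

/-- the list of `4 v^n` -/
def bmono : ℕ → List ℕ
  | 0 => [4]
  | n + 1 => 0 :: bmono n

theorem bev_mono (n : ℕ) : bev (bmono n) = - T (n : ℤ) := by
  induction n with
  | zero =>
    simp only [bmono, bev, Nat.cast_zero, T_zero]
    push_cast
    linear_combination five_zero
  | succ n ih =>
    simp only [bmono, bev, ih]
    push_cast
    rw [add_comm (n : ℤ) 1, T_add]; ring

set_option maxRecDepth 100000 in
theorem brow0 : bcheck (Wword.foldl bstep ⟨[1], [], []⟩) ⟨[], [], bmono 108⟩ = true := by
  decide +kernel

set_option maxRecDepth 100000 in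
theorem brow1 : bcheck (Wword.foldl bstep ⟨[], [1], []⟩) ⟨[], bmono 108, []⟩ = true := by
  decide +kernel

set_option maxRecDepth 100000 in
theorem brow2 : bcheck (Wword.foldl bstep ⟨[], [], [1]⟩) ⟨bmono 108, [], []⟩ = true := by
  decide +kernel

/-- Over `(ℤ/5ℤ)[v,v⁻¹]`, the product of the Burau matrices along the word `W`
equals `-v^108 · J`, the 5-Burau matrix of `Δ^27`. -/
theorem burau_word_product_mod_five :
    (Wword.map (BurauB (ZMod 5))).prod = (-(T 108 : LaurentPolynomial (ZMod 5))) • Jmat (ZMod 5) := by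
  have h0 := bcheck_vec _ _ brow0
  have h1 := bcheck_vec _ _ brow1
  have h2 := bcheck_vec _ _ brow2
  rw [brun_vec] at h0 h1 h2
  generalize (Wword.map (BurauB (ZMod 5))).prod = M at h0 h1 h2 ⊢
  have hm := bev_mono 108
  push_cast at hm
  ext1 i j
  have a0 := congrFun h0 j
  have a1 := congrFun h1 j
  have a2 := congrFun h2 j
  fin_cases i <;> fin_cases j <;>
    simp [BRow.vec, bev, Matrix.vecMul, dotProduct, Fin.sum_univ_three, Jmat, hm] at a0 a1 a2 ⊢ <;>
    assumption
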